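/- arXiv:2203.16227 — 3 statements merged into one kernel-verified Lean document; each statement's English description precedes it below -/
import Mathlib

section
/- The transport cost is jointly convex: for all μ₀, μ₁ ∈ P(X), ν₀, ν₁ ∈ P(Y) and t ∈ [0,1], I_c((1−t)μ₀ + tμ₁, (1−t)ν₀ + tν₁) ≤ (1−t)·I_c(μ₀,ν₀) + t·I_c(μ₁,ν₁), the inequality being understood in ℝ ∪ {+∞}. -/
open MeasureTheory ProbabilityTheory Topology Filter Set Metric
open scoped NNReal ENNReal

noncomputable section

namespace UWOT

/-- The nonnegative part of an extended real, as an extended nonnegative real. -/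
def epos (x : EReal) : ℝ≥0∞ := if x = ⊤ then ⊤ else ENNReal.ofReal x.toReal

/-- Integral of an `EReal`-valued function: positive part minus negative part. -/
def eintegral {α : Type*} [MeasurableSpace α] (μ : Measure α) (g : α → EReal) : EReal :=
  ((∫⁻ x, epos (g x) ∂μ : ℝ≥0∞) : EReal) - ((∫⁻ x, epos (-(g x)) ∂μ : ℝ≥0∞) : EReal)

/-- Integral of a real-valued function, with value `+∞` when the positive part is not
integrable.  This is the integral "understood in `ℝ ∪ {+∞}`". -/
def eintegralR {α : Type*} [MeasurableSpace α] (μ : Measure α) (f : α → ℝ) : EReal :=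
  eintegral μ fun x => (f x : EReal)

variable {X Y : Type*}
  [TopologicalSpace X] [PolishSpace X] [MeasurableSpace X] [BorelSpace X]
  [TopologicalSpace Y] [PolishSpace Y] [MeasurableSpace Y] [BorelSpace Y]

/-- A nonnegative kernel from `X` to `Y` : a measurable family of finite nonnegative
measures on `Y`. -/
def IsKernel (q : X → FiniteMeasure Y) : Prop :=
  Measurable fun x => (q x : Measure Y)

/-- `μ q = ν` : the kernel `q` transports `μ` onto `ν`. -/
def Transports (μ : Measure X) (q : X → FiniteMeasure Y) (ν : Measure Y) : Prop :=
  μ.bind (fun x => (q x : Measure Y)) = ν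

/-- The transport cost `I_c(μ,ν)`, an infimum in `ℝ ∪ {+∞}` (it equals `⊤` when no
admissible kernel exists). -/
def transportCost (c : X → FiniteMeasure Y → ℝ) (μ : Measure X) (ν : Measure Y) : EReal :=
  sInf {r : EReal | ∃ q : X → FiniteMeasure Y,
    IsKernel q ∧ Transports μ q ν ∧ r = eintegralR μ fun x => c x (q x)}

/-- Standing assumptions on the cost function: convexity in the second variable, joint
lower semicontinuity, and the lower bound (LB). -/
structure IsCost (c : X → FiniteMeasure Y → ℝ) : Prop where
  convex : ∀ (x : X) (m₀ m₁ : FiniteMeasure Y) (t : ℝ≥0), t ≤ 1 →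
    c x ((1 - t) • m₀ + t • m₁) ≤ (1 - (t : ℝ)) * c x m₀ + (t : ℝ) * c x m₁
  lsc : LowerSemicontinuous fun p : X × FiniteMeasure Y => c p.1 p.2
  lb : ∃ r₀ r₁ : ℝ, ∀ (x : X) (m : FiniteMeasure Y), r₀ + r₁ * (m.mass : ℝ) ≤ c x m

/-- The topological support of a measure. -/
def msupport {Z : Type*} [TopologicalSpace Z] [MeasurableSpace Z] (μ : Measure Z) : Set Z :=
  {x | ∀ U : Set Z, IsOpen U → x ∈ U → 0 < μ U}

/-- Membership in `Π(≪ μ, ν)`. -/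
def MemPiAC (μ : Measure X) (ν : Measure Y) (π : ProbabilityMeasure (X × Y)) : Prop :=
  (π : Measure (X × Y)).fst ≪ μ ∧ (π : Measure (X × Y)).snd = ν

/-- Membership in `Π(Supp(μ), ν)`. -/
def MemPiSupp (μ : Measure X) (ν : Measure Y) (π : ProbabilityMeasure (X × Y)) : Prop :=
  (π : Measure (X × Y)).fst (msupport μ) = 1 ∧ (π : Measure (X × Y)).snd = ν

variable [Nonempty Y]

/-- The disintegration kernel `π^x` of `π` with respect to its first marginal, as a
finite (probability) measure. -/
def condFM (π : ProbabilityMeasure (X × Y)) (x : X) : FiniteMeasure Y :=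
  ⟨(π : Measure (X × Y)).condKernel x, inferInstance⟩

/-- The measure `(dπ₁/dμ)(x) • π^x`. -/
def fiber (μ : Measure X) (π : ProbabilityMeasure (X × Y)) (x : X) : FiniteMeasure Y :=
  ((π : Measure (X × Y)).fst.rnDeriv μ x).toNNReal • condFM π x

/-- The functional `I_c^μ[π] = ∫ c(x, (dπ₁/dμ)(x) π^x) dμ`, in `ℝ ∪ {+∞}`. -/
def Icmu (c : X → FiniteMeasure Y → ℝ) (μ : Measure X) (π : ProbabilityMeasure (X × Y)) :
    EReal :=
  eintegralR μ fun x => c x (fiber μ π x)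

/-- A strong solution of the transport problem. -/
def IsStrongSol (c : X → FiniteMeasure Y → ℝ) (μ : Measure X) (ν : Measure Y)
    (π : ProbabilityMeasure (X × Y)) : Prop :=
  MemPiAC μ ν π ∧ Icmu c μ π = transportCost c μ ν

/-- A weak solution of the transport problem. -/
def IsWeakSol (c : X → FiniteMeasure Y → ℝ) (μ : Measure X) (ν : Measure Y)
    (π : ProbabilityMeasure (X × Y)) : Prop :=
  ∃ s : ℕ → ProbabilityMeasure (X × Y), (∀ n, MemPiAC μ ν (s n)) ∧
    Tendsto s atTop (𝓝 π) ∧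
    Tendsto (fun n => Icmu c μ (s n)) atTop (𝓝 (transportCost c μ ν))

/-- The recession function `c'_∞(x,m) = lim_{λ→∞} c(x, λm)/λ`. -/
def recession (c : X → FiniteMeasure Y → ℝ) (x : X) (m : FiniteMeasure Y) : EReal :=
  limsup (fun lam : ℝ≥0 => ((c x (lam • m) / (lam : ℝ) : ℝ) : EReal)) atTop

/-- The extended functional `bar I_c^μ[π]`. -/
def barI (c : X → FiniteMeasure Y → ℝ) (μ : Measure X) (π : ProbabilityMeasure (X × Y)) :
    EReal :=
  eintegralR μ (fun x => c x (fiber μ π x)) +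
    eintegral ((π : Measure (X × Y)).fst.singularPart μ) (fun x => recession c x (condFM π x))

/-- Assumption (A). -/
def AssumpA (c : X → FiniteMeasure Y → ℝ) : Prop :=
  ∃ (a : ℕ → C(X, ℝ)) (b : ℕ → C(X × Y, ℝ)),
    ∀ (x : X) (m : FiniteMeasure Y),
      IsLUB (range fun k => (∫ y, b k (x, y) ∂(m : Measure Y)) + a k x) (c x m)

/-- Assumption (B). -/
def AssumpB (c : X → FiniteMeasure Y → ℝ) : Prop :=
  ∀ (x : X) (m : FiniteMeasure Y), m ≠ 0 →
    Tendsto (fun lam : ℝ≥0 => c x (lam • m) / (lam : ℝ)) atTop atTop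

/-- Assumption (C). -/
def AssumpC (c : X → FiniteMeasure Y → ℝ) : Prop :=
  (∀ m : FiniteMeasure Y, Continuous fun x : X => c x m) ∧
  (∀ m : FiniteMeasure Y, Continuous fun x : X => recession c x m) ∧
  (∃ a : ℝ, 0 ≤ a ∧
    ∀ (x : X) (p : FiniteMeasure Y), p.mass = 1 → recession c x p ≤ (a : EReal))

/-- Assumption (Approx). -/
def AssumpApprox (c : X → FiniteMeasure Y → ℝ) : Prop :=
  ∀ (μ : Measure X) (ν : Measure Y), IsProbabilityMeasure μ → IsProbabilityMeasure ν →
    ∀ π : ProbabilityMeasure (X × Y), MemPiSupp μ ν π →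
      ∃ s : ℕ → ProbabilityMeasure (X × Y), (∀ n, MemPiAC μ ν (s n)) ∧
        Tendsto (fun n => Icmu c μ (s n)) atTop (𝓝 (barI c μ π))

/-- The operator `K_c` acting on continuous functions. -/
def Kc (c : X → FiniteMeasure Y → ℝ) (f : Y → ℝ) (x : X) : EReal :=
  ⨅ m : FiniteMeasure Y, (((∫ y, f y ∂(m : Measure Y)) + c x m : ℝ) : EReal)


section FiniteMeasureTopology

theorem measurable_testAgainstNN {Z : Type*} [TopologicalSpace Z] [MeasurableSpace Z]
    [OpensMeasurableSpace Z] (f : BoundedContinuousFunction Z ℝ≥0) :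
    Measurable fun m : FiniteMeasure Z => m.testAgainstNN f :=
  ((Measure.measurable_lintegral (by fun_prop)).comp measurable_subtype_coe).ennreal_toNNReal

/-- The weak topology on finite measures is induced by the total mass together with the
evaluations at a dense family of test functions. -/
theorem isInducing_mass_testAgainstNN {Z : Type*} [TopologicalSpace Z] [MeasurableSpace Z]
    [OpensMeasurableSpace Z] {ι : Type*} {f : ι → BoundedContinuousFunction Z ℝ≥0}
    (hf : DenseRange f) :
    IsInducing fun m : FiniteMeasure Z => (m.mass, fun i => m.testAgainstNN (f i)) := by
  set Φ : FiniteMeasure Z → ℝ≥0 × (ι → ℝ≥0) :=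
    fun m => (m.mass, fun i => m.testAgainstNN (f i))
  have hcont : Continuous Φ :=
    (FiniteMeasure.continuous_mass (Ω := Z)).prodMk
      (continuous_pi fun i => FiniteMeasure.continuous_testAgainstNN_eval (f i))
  rw [isInducing_iff_nhds]
  intro m
  refine le_antisymm (hcont.tendsto m).le_comap ?_
  have hΦt : Tendsto Φ (comap Φ (𝓝 (Φ m))) (𝓝 (Φ m)) := tendsto_comap
  have hmass : Tendsto (fun m' : FiniteMeasure Z => m'.mass) (comap Φ (𝓝 (Φ m))) (𝓝 m.mass) :=
    (continuous_fst.tendsto _).comp hΦt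
  have heval (i : ι) : Tendsto (fun m' : FiniteMeasure Z => m'.testAgainstNN (f i))
      (comap Φ (𝓝 (Φ m))) (𝓝 (m.testAgainstNN (f i))) :=
    (((continuous_apply i).comp continuous_snd).tendsto _).comp hΦt
  rw [← tendsto_id', FiniteMeasure.tendsto_iff_forall_testAgainstNN_tendsto]
  intro g
  rw [Metric.tendsto_nhds]
  intro ε hε
  obtain ⟨i, hi⟩ := hf.exists_dist_lt g (ε := ε / (3 * (m.mass + 1))) (by positivity)
  have hlt : ∀ᶠ m' in comap Φ (𝓝 (Φ m)), m'.mass < m.mass + 1 :=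
    hmass.eventually_lt_const (by simp)
  filter_upwards [hlt, Metric.tendsto_nhds.1 (heval i) (ε / 3) (by positivity)] with m' h₁ h₂
  have key (n : FiniteMeasure Z) (hn : (n.mass : ℝ) ≤ m.mass + 1) :
      dist (n.testAgainstNN g) (n.testAgainstNN (f i)) ≤ ε / 3 := by
    calc dist (n.testAgainstNN g) (n.testAgainstNN (f i))
        ≤ n.mass * dist g (f i) := n.testAgainstNN_lipschitz.dist_le_mul _ _
      _ ≤ (m.mass + 1) * (ε / (3 * (m.mass + 1))) := by gcongr
      _ = ε / 3 := by field_simp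
  have h₃ := key m' (by exact_mod_cast h₁.le)
  have h₄ := key m (by linarith)
  rw [dist_comm] at h₄
  have h₅ := dist_triangle4 (m'.testAgainstNN g) (m'.testAgainstNN (f i))
    (m.testAgainstNN (f i)) (m.testAgainstNN g)
  simp only [id]
  linarith

variable {Z : Type*} [TopologicalSpace Z] [PolishSpace Z] [CompactSpace Z]
  [MeasurableSpace Z] [BorelSpace Z]

/-- Nonnegative continuous functions on a compact Polish space have a dense sequence. -/
theorem exists_denseRange_boundedContinuousFunction (Z : Type*) [TopologicalSpace Z]
    [PolishSpace Z] [CompactSpace Z] :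
    ∃ f : ℕ → BoundedContinuousFunction Z ℝ≥0, DenseRange f :=
  ⟨_, (ContinuousMap.isometryEquivBoundedOfCompact Z ℝ≥0).surjective.denseRange.comp
    (TopologicalSpace.denseRange_denseSeq C(Z, ℝ≥0))
    (ContinuousMap.isometryEquivBoundedOfCompact Z ℝ≥0).continuous⟩

instance secondCountableTopology_finiteMeasure :
    SecondCountableTopology (FiniteMeasure Z) := by
  obtain ⟨f, hf⟩ := exists_denseRange_boundedContinuousFunction Z
  exact (isInducing_mass_testAgainstNN hf).secondCountableTopology

instance opensMeasurableSpace_finiteMeasure : OpensMeasurableSpace (FiniteMeasure Z) := by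
  obtain ⟨f, hf⟩ := exists_denseRange_boundedContinuousFunction Z
  have hΦ := isInducing_mass_testAgainstNN hf
  have hmeas : Measurable fun m : FiniteMeasure Z => (m.mass, fun i => m.testAgainstNN (f i)) := by
    refine Measurable.prodMk ?_ (measurable_pi_lambda _ fun i => measurable_testAgainstNN _)
    simpa using measurable_testAgainstNN (1 : BoundedContinuousFunction Z ℝ≥0)
  constructor
  rw [hΦ.eq_induced, borel_comap, ← BorelSpace.measurable_eq]
  exact hmeas.comap_le

end FiniteMeasureTopology

section ExtendedIntegral

variable {α : Type*} [MeasurableSpace α] {μ : Measure α} {f g : α → ℝ}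

theorem epos_coe (x : ℝ) : epos (x : EReal) = ENNReal.ofReal x := by
  simp [epos]

theorem eintegralR_eq (μ : Measure α) (f : α → ℝ) :
    eintegralR μ f = ((∫⁻ x, ENNReal.ofReal (f x) ∂μ : ℝ≥0∞) : EReal)
      - ((∫⁻ x, ENNReal.ofReal (-f x) ∂μ : ℝ≥0∞) : EReal) := by
  simp only [eintegralR, eintegral, ← EReal.coe_neg, epos_coe]

theorem eintegralR_eq_integral (hf : Integrable f μ) :
    eintegralR μ f = ((∫ x, f x ∂μ : ℝ) : EReal) := by
  have hpos : ∫⁻ x, ENNReal.ofReal (f x) ∂μ ≠ ⊤ := hf.lintegral_lt_top.ne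
  have hneg : ∫⁻ x, ENNReal.ofReal (-f x) ∂μ ≠ ⊤ := hf.neg.lintegral_lt_top.ne
  rw [eintegralR_eq, integral_eq_lintegral_pos_part_sub_lintegral_neg_part hf, EReal.coe_sub,
    EReal.coe_ennreal_toReal hpos, EReal.coe_ennreal_toReal hneg]

/-- A measurable function which is bounded below by an integrable one and whose extended
integral is not `⊤` is integrable. -/
theorem integrable_of_eintegralR_ne_top (hf : Measurable f) (hg : Integrable g μ)
    (hgf : ∀ x, g x ≤ f x) (h : eintegralR μ f ≠ ⊤) : Integrable f μ := by
  have hneg : ∫⁻ x, ENNReal.ofReal (-f x) ∂μ ≠ ⊤ :=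
    ((lintegral_mono fun x => ENNReal.ofReal_le_ofReal (neg_le_neg (hgf x))).trans_lt
      hg.neg.lintegral_lt_top).ne
  have hpos : ∫⁻ x, ENNReal.ofReal (f x) ∂μ ≠ ⊤ := by
    intro htop
    apply h
    rw [eintegralR_eq, htop, EReal.coe_ennreal_top, ← EReal.coe_ennreal_toReal hneg,
      EReal.top_sub_coe]
  refine ⟨hf.aestronglyMeasurable, ?_⟩
  have henorm (x : α) : ‖f x‖ₑ = ENNReal.ofReal (f x) + ENNReal.ofReal (-f x) := by
    rw [Real.enorm_eq_ofReal_abs]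
    rcases le_total 0 (f x) with hx | hx
    · rw [abs_of_nonneg hx, ENNReal.ofReal_of_nonpos (neg_nonpos.2 hx), add_zero]
    · rw [abs_of_nonpos hx, ENNReal.ofReal_of_nonpos hx, zero_add]
  rw [HasFiniteIntegral, lintegral_congr henorm, lintegral_add_left hf.ennreal_ofReal]
  exact ENNReal.add_lt_top.2 ⟨hpos.lt_top, hneg.lt_top⟩

end ExtendedIntegral

section Densities

variable {α : Type*} [MeasurableSpace α]

/-- Two finite measures have densities with respect to their sum which add up to `1`. -/
theorem exists_density_add (μ ν : Measure α) [IsFiniteMeasure μ] [IsFiniteMeasure ν] :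
    ∃ b : α → ℝ≥0, Measurable b ∧ (∀ x, b x ≤ 1) ∧
      (μ + ν).withDensity (fun x => ((1 - b x : ℝ≥0) : ℝ≥0∞)) = μ ∧
      (μ + ν).withDensity (fun x => (b x : ℝ≥0∞)) = ν := by
  have hle : ν ≤ μ + ν := Measure.le_add_left le_rfl
  set b : α → ℝ≥0 := fun x => min (ν.rnDeriv (μ + ν) x).toNNReal 1 with hb
  have hbm : Measurable b := (Measure.measurable_rnDeriv _ _).ennreal_toNNReal.min measurable_const
  have hν : (μ + ν).withDensity (fun x => (b x : ℝ≥0∞)) = ν := by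
    conv_rhs => rw [← Measure.withDensity_rnDeriv_eq ν (μ + ν) hle.absolutelyContinuous]
    refine withDensity_congr_ae ?_
    filter_upwards [Measure.rnDeriv_le_one_of_le hle] with x hx
    have hx' : ν.rnDeriv (μ + ν) x ≤ 1 := hx
    have htop : ν.rnDeriv (μ + ν) x ≠ ⊤ := (hx'.trans_lt ENNReal.one_lt_top).ne
    rw [hb]
    simp only [ENNReal.coe_min, ENNReal.coe_toNNReal htop, ENNReal.coe_one, min_eq_left hx']
  refine ⟨b, hbm, fun x => min_le_right _ _, ?_, hν⟩
  have hsum : (μ + ν).withDensity (fun x => ((1 - b x : ℝ≥0) : ℝ≥0∞)) + ν = μ + ν := by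
    nth_rewrite 2 [← hν]
    rw [← withDensity_add_right _ hbm.coe_nnreal_ennreal]
    conv_rhs => rw [← withDensity_one (μ := μ + ν)]
    congr 1
    ext x
    simp only [Pi.add_apply, Pi.one_apply, ← ENNReal.coe_add]
    rw [tsub_add_cancel_of_le (min_le_right _ _), ENNReal.coe_one]
  ext s hs
  have := congrArg (fun m : Measure α => m s) hsum
  simp only [Measure.add_apply] at this
  exact (ENNReal.add_left_inj (measure_ne_top ν s)).1 this

end Densities

section Kernels

variable {S T : Type*} [MeasurableSpace S] [MeasurableSpace T] {q q₀ q₁ : S → FiniteMeasure T}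

theorem Transports.lintegral_mass {μ : Measure S} {ν : Measure T} (hq : IsKernel q)
    (h : Transports μ q ν) : ∫⁻ x, ((q x).mass : ℝ≥0∞) ∂μ = ν univ := by
  rw [← h, Measure.bind_apply MeasurableSet.univ hq.aemeasurable]
  simp only [FiniteMeasure.ennreal_mass]

theorem IsKernel.measurable_mass (hq : IsKernel q) : Measurable fun x => (q x).mass :=
  ((Measure.measurable_coe MeasurableSet.univ).comp hq).ennreal_toNNReal

theorem Transports.integrable_mass {μ : Measure S} {ν : Measure T} [IsFiniteMeasure ν]
    (hq : IsKernel q) (h : Transports μ q ν) : Integrable (fun x => ((q x).mass : ℝ)) μ := by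
  refine ⟨hq.measurable_mass.coe_nnreal_real.aestronglyMeasurable, ?_⟩
  simp only [HasFiniteIntegral, NNReal.enorm_eq, h.lintegral_mass hq]
  exact measure_lt_top ν univ

theorem Transports.integral_mass {μ : Measure S} {ν : Measure T} (hq : IsKernel q)
    (h : Transports μ q ν) : ∫ x, ((q x).mass : ℝ) ∂μ = ν.real univ := by
  rw [integral_eq_lintegral_of_nonneg_ae (ae_of_all _ fun x => NNReal.coe_nonneg (q x).mass)
    hq.measurable_mass.coe_nnreal_real.aestronglyMeasurable, Measure.real, ← h.lintegral_mass hq]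
  simp only [ENNReal.ofReal_coe_nnreal]

theorem Transports.smul {μ : Measure S} {ν : Measure T} (h : Transports μ q ν) (a : ℝ≥0) :
    Transports (a • μ) q (a • ν) := by
  rw [Transports, Measure.bind_smul, h]

/-- Mixing two kernels with weights `1 - b` and `b`. -/
def mixKernel (b : S → ℝ≥0) (q₀ q₁ : S → FiniteMeasure T) (x : S) : FiniteMeasure T :=
  (1 - b x) • q₀ x + b x • q₁ x

theorem mixKernel_apply {S T : Type*} [MeasurableSpace T] (b : S → ℝ≥0)
    (q₀ q₁ : S → FiniteMeasure T) (x : S) (s : Set T) :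
    (mixKernel b q₀ q₁ x : Measure T) s =
      ((1 - b x : ℝ≥0) : ℝ≥0∞) * (q₀ x : Measure T) s + (b x : ℝ≥0∞) * (q₁ x : Measure T) s :=
  rfl

theorem isKernel_mixKernel {b : S → ℝ≥0} (hb : Measurable b) (hq₀ : IsKernel q₀)
    (hq₁ : IsKernel q₁) : IsKernel (mixKernel b q₀ q₁) := by
  refine Measure.measurable_of_measurable_coe _ fun s hs => ?_
  simp only [mixKernel_apply]
  have h₀ : Measurable fun x => (q₀ x : Measure T) s := (Measure.measurable_coe hs).comp hq₀
  have h₁ : Measurable fun x => (q₁ x : Measure T) s := (Measure.measurable_coe hs).comp hq₁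
  fun_prop

theorem bind_mixKernel {b : S → ℝ≥0} (hb : Measurable b) (hq₀ : IsKernel q₀)
    (hq₁ : IsKernel q₁) (μ : Measure S) :
    μ.bind (fun x => (mixKernel b q₀ q₁ x : Measure T)) =
      (μ.withDensity fun x => ((1 - b x : ℝ≥0) : ℝ≥0∞)).bind (fun x => (q₀ x : Measure T)) +
        (μ.withDensity fun x => (b x : ℝ≥0∞)).bind (fun x => (q₁ x : Measure T)) := by
  ext s hs
  have h₀ : Measurable fun x => (q₀ x : Measure T) s := (Measure.measurable_coe hs).comp hq₀
  have h₁ : Measurable fun x => (q₁ x : Measure T) s := (Measure.measurable_coe hs).comp hq₁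
  have hb' : Measurable fun x => ((1 - b x : ℝ≥0) : ℝ≥0∞) := by fun_prop
  rw [Measure.add_apply,
    Measure.bind_apply hs (isKernel_mixKernel hb hq₀ hq₁).aemeasurable,
    Measure.bind_apply hs hq₀.aemeasurable, Measure.bind_apply hs hq₁.aemeasurable,
    lintegral_withDensity_eq_lintegral_mul _ hb' h₀,
    lintegral_withDensity_eq_lintegral_mul _ hb.coe_nnreal_ennreal h₁,
    ← lintegral_add_left (hb'.mul h₀)]
  rfl

end Kernels

section Cost

variable {S T : Type*}
  [TopologicalSpace S] [MeasurableSpace S] [BorelSpace S]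
  [TopologicalSpace T] [PolishSpace T] [MeasurableSpace T] [BorelSpace T]
  {c : S → FiniteMeasure T → ℝ} {q q₀ q₁ : S → FiniteMeasure T}

theorem IsCost.measurable_comp [CompactSpace T] (hc : IsCost c) (hq : IsKernel q) :
    Measurable fun x => c x (q x) :=
  hc.lsc.measurable.comp (measurable_id.prodMk (hq.subtype_mk (h := fun x => (q x).2)))

/-- An admissible kernel whose cost is not `⊤` has integrable cost. -/
theorem Transports.integrable_cost [CompactSpace T] {μ : Measure S} {ν : Measure T}
    [IsFiniteMeasure μ] [IsFiniteMeasure ν] (hc : IsCost c) (hq : IsKernel q)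
    (h : Transports μ q ν) (htop : eintegralR μ (fun x => c x (q x)) ≠ ⊤) :
    Integrable (fun x => c x (q x)) μ := by
  obtain ⟨r₀, r₁, hr⟩ := hc.lb
  exact integrable_of_eintegralR_ne_top (hc.measurable_comp hq)
    ((integrable_const r₀).add ((h.integrable_mass hq).const_mul r₁)) (fun x => hr x (q x)) htop

theorem transportCost_ne_bot [CompactSpace T] (hc : IsCost c) (μ : Measure S) (ν : Measure T)
    [IsFiniteMeasure μ] [IsFiniteMeasure ν] : transportCost c μ ν ≠ ⊥ := by
  obtain ⟨r₀, r₁, hr⟩ := hc.lb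
  suffices h : ((μ.real univ * r₀ + r₁ * ν.real univ : ℝ) : EReal) ≤ transportCost c μ ν from
    ((EReal.bot_lt_coe _).trans_le h).ne'
  refine le_sInf ?_
  rintro _ ⟨q, hq, hqν, rfl⟩
  by_cases htop : eintegralR μ (fun x => c x (q x)) = ⊤
  · rw [htop]
    exact le_top
  have hint := hqν.integrable_cost hc hq htop
  have hmass := (hqν.integrable_mass hq).const_mul r₁
  rw [eintegralR_eq_integral hint, EReal.coe_le_coe_iff]
  calc μ.real univ * r₀ + r₁ * ν.real univ
      = ∫ x, (r₀ + r₁ * ((q x).mass : ℝ)) ∂μ := by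
        rw [integral_add (integrable_const r₀) hmass, integral_const, integral_const_mul,
          hqν.integral_mass hq, smul_eq_mul]
    _ ≤ ∫ x, c x (q x) ∂μ :=
        integral_mono ((integrable_const r₀).add hmass) hint fun x => hr x (q x)

/-- The transport cost is subadditive along kernels of integrable cost. -/
theorem transportCost_add_le [CompactSpace T] (hc : IsCost c) {μ₀ μ₁ : Measure S}
    {ν₀ ν₁ : Measure T} [IsFiniteMeasure μ₀] [IsFiniteMeasure μ₁] [IsFiniteMeasure ν₀]
    [IsFiniteMeasure ν₁] (hq₀ : IsKernel q₀) (hq₁ : IsKernel q₁) (h₀ : Transports μ₀ q₀ ν₀)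
    (h₁ : Transports μ₁ q₁ ν₁) (hi₀ : Integrable (fun x => c x (q₀ x)) μ₀)
    (hi₁ : Integrable (fun x => c x (q₁ x)) μ₁) :
    transportCost c (μ₀ + μ₁) (ν₀ + ν₁) ≤
      ((∫ x, c x (q₀ x) ∂μ₀ + ∫ x, c x (q₁ x) ∂μ₁ : ℝ) : EReal) := by
  obtain ⟨b, hb, hb1, hd₀, hd₁⟩ := exists_density_add μ₀ μ₁
  have hb' : Measurable fun x => 1 - b x := by fun_prop
  set q := mixKernel b q₀ q₁
  have hq : IsKernel q := isKernel_mixKernel hb hq₀ hq₁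
  have hqν : Transports (μ₀ + μ₁) q (ν₀ + ν₁) := by
    rw [Transports, bind_mixKernel hb hq₀ hq₁, hd₀, hd₁, h₀, h₁]
  have hj₀ : Integrable (fun x => (1 - b x) • c x (q₀ x)) (μ₀ + μ₁) :=
    (integrable_withDensity_iff_integrable_smul hb').1 (by rwa [hd₀])
  have hj₁ : Integrable (fun x => b x • c x (q₁ x)) (μ₀ + μ₁) :=
    (integrable_withDensity_iff_integrable_smul hb).1 (by rwa [hd₁])
  have hle (x : S) : c x (q x) ≤ (1 - b x) • c x (q₀ x) + b x • c x (q₁ x) := by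
    simp only [NNReal.smul_def, smul_eq_mul, NNReal.coe_sub (hb1 x), NNReal.coe_one]
    exact hc.convex x (q₀ x) (q₁ x) (b x) (hb1 x)
  obtain ⟨r₀, r₁, hr⟩ := hc.lb
  have hi : Integrable (fun x => c x (q x)) (μ₀ + μ₁) :=
    integrable_of_le_of_le (hc.measurable_comp hq).aestronglyMeasurable
      (ae_of_all _ fun x => hr x (q x)) (ae_of_all _ hle)
      ((integrable_const r₀).add ((hqν.integrable_mass hq).const_mul r₁)) (hj₀.add hj₁)
  calc transportCost c (μ₀ + μ₁) (ν₀ + ν₁)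
      ≤ eintegralR (μ₀ + μ₁) (fun x => c x (q x)) := sInf_le ⟨q, hq, hqν, rfl⟩
    _ = ((∫ x, c x (q x) ∂(μ₀ + μ₁) : ℝ) : EReal) := eintegralR_eq_integral hi
    _ ≤ ((∫ x, ((1 - b x) • c x (q₀ x) + b x • c x (q₁ x)) ∂(μ₀ + μ₁) : ℝ) : EReal) :=
        EReal.coe_le_coe_iff.2 (integral_mono hi (hj₀.add hj₁) hle)
    _ = _ := by
        rw [integral_add hj₀ hj₁, ← integral_withDensity_eq_integral_smul hb',
          ← integral_withDensity_eq_integral_smul hb, hd₀, hd₁]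

/-- A finite transport cost is approximated by integrals of the cost of admissible kernels. -/
theorem exists_integral_cost_lt [CompactSpace T] (hc : IsCost c) {μ : Measure S} {ν : Measure T}
    [IsFiniteMeasure μ] [IsFiniteMeasure ν] {r : ℝ} (hr : transportCost c μ ν < r) :
    ∃ q : S → FiniteMeasure T, IsKernel q ∧ Transports μ q ν ∧
      Integrable (fun x => c x (q x)) μ ∧ ∫ x, c x (q x) ∂μ < r := by
  obtain ⟨_, ⟨q, hq, hqν, rfl⟩, hlt⟩ := sInf_lt_iff.1 hr
  have hint := hqν.integrable_cost hc hq (hlt.trans (EReal.coe_lt_top r)).ne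
  rw [eintegralR_eq_integral hint, EReal.coe_lt_coe_iff] at hlt
  exact ⟨q, hq, hqν, hint, hlt⟩

end Cost

/-- Proposition `prop:convexity`: joint convexity of the transport cost
`(μ,ν) ↦ I_c(μ,ν)`, the inequality being understood in `ℝ ∪ {+∞}` (here `EReal`). -/
theorem transportCost_convex
    [CompactSpace X] [CompactSpace Y]
    (c : X → FiniteMeasure Y → ℝ) (hc : IsCost c)
    (μ₀ μ₁ : Measure X) (ν₀ ν₁ : Measure Y)
    [IsProbabilityMeasure μ₀] [IsProbabilityMeasure μ₁]
    [IsProbabilityMeasure ν₀] [IsProbabilityMeasure ν₁]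
    (t : ℝ≥0) (ht : t ≤ 1) :
    transportCost c ((1 - t) • μ₀ + t • μ₁) ((1 - t) • ν₀ + t • ν₁) ≤
      ((1 - (t : ℝ) : ℝ) : EReal) * transportCost c μ₀ ν₀ +
        ((t : ℝ) : EReal) * transportCost c μ₁ ν₁ := by
  have hs : ((1 - t : ℝ≥0) : ℝ) = 1 - (t : ℝ) := by rw [NNReal.coe_sub ht, NNReal.coe_one]
  rcases eq_or_ne t 0 with rfl | ht₀
  · simp
  rcases eq_or_ne t 1 with rfl | ht₁
  · simp
  have htpos : (0 : ℝ) < t := by exact_mod_cast pos_iff_ne_zero.2 ht₀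
  have hspos : (0 : ℝ) < 1 - t := sub_pos.2 (by exact_mod_cast lt_of_le_of_ne ht ht₁)
  have hbot₀ := transportCost_ne_bot hc μ₀ ν₀
  have hbot₁ := transportCost_ne_bot hc μ₁ ν₁
  generalize hI₀ : transportCost c μ₀ ν₀ = I₀ at *
  generalize hI₁ : transportCost c μ₁ ν₁ = I₁ at *
  induction I₀ with
  | bot => exact absurd rfl hbot₀
  | top =>
    rw [EReal.coe_mul_top_of_pos hspos, EReal.top_add_of_ne_bot]
    · exact le_top
    · induction I₁ with
      | bot => exact absurd rfl hbot₁
      | top => simp [EReal.coe_mul_top_of_pos htpos]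
      | coe i₁ => exact EReal.coe_ne_bot (t * i₁)
  | coe i₀ =>
    induction I₁ with
    | bot => exact absurd rfl hbot₁
    | top =>
      rw [EReal.coe_mul_top_of_pos htpos, EReal.add_top_of_ne_bot]
      · exact le_top
      · exact EReal.coe_ne_bot ((1 - t) * i₀)
    | coe i₁ =>
      rw [← EReal.coe_mul, ← EReal.coe_mul, ← EReal.coe_add]
      refine EReal.le_of_forall_lt_iff_le.1 fun z hz => ?_
      rw [EReal.coe_lt_coe_iff] at hz
      set ε := z - ((1 - t) * i₀ + t * i₁) with hε
      have hεpos : 0 < ε := sub_pos.2 hz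
      obtain ⟨q₀, hq₀, hT₀, hi₀, hlt₀⟩ := exists_integral_cost_lt hc (μ := μ₀) (ν := ν₀)
        (r := i₀ + ε) (by rw [hI₀, EReal.coe_lt_coe_iff]; linarith)
      obtain ⟨q₁, hq₁, hT₁, hi₁, hlt₁⟩ := exists_integral_cost_lt hc (μ := μ₁) (ν := ν₁)
        (r := i₁ + ε) (by rw [hI₁, EReal.coe_lt_coe_iff]; linarith)
      refine (transportCost_add_le hc hq₀ hq₁ (hT₀.smul (1 - t)) (hT₁.smul t)
        hi₀.smul_measure_nnreal hi₁.smul_measure_nnreal).trans (EReal.coe_le_coe_iff.2 ?_)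
      rw [integral_smul_nnreal_measure, integral_smul_nnreal_measure, NNReal.smul_def,
        NNReal.smul_def, hs, smul_eq_mul, smul_eq_mul]
      have e₀ := mul_le_mul_of_nonneg_left hlt₀.le hspos.le
      have e₁ := mul_le_mul_of_nonneg_left hlt₁.le htpos.le
      linarith

end UWOT
end
end

section
/- For any μ ∈ P(X) and ν ∈ P(Y), the closure of Π(≪μ,ν) in P(X×Y) for the weak topology equals Π(Supp(μ),ν). -/
open MeasureTheory ProbabilityTheory Topology Filter Set Metric
open scoped NNReal ENNReal

noncomputable section

namespace UWOT

variable {X Y : Type*}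
  [TopologicalSpace X] [PolishSpace X] [MeasurableSpace X] [BorelSpace X]
  [TopologicalSpace Y] [PolishSpace Y] [MeasurableSpace Y] [BorelSpace Y]

variable [Nonempty Y]

/-- Every finite nonzero measure `μ` on a separable metric space admits Markov kernels that are
absolutely continuous with respect to `μ` and move points of the support by less than `δ`. -/
theorem exists_markovKernel_absolutelyContinuous_dist_lt {α : Type*} [PseudoMetricSpace α]
    [SecondCountableTopology α] [MeasurableSpace α] [BorelSpace α]
    (μ : Measure α) [IsFiniteMeasure μ] (hμ : μ ≠ 0) {δ : ℝ} (hδ : 0 < δ) :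
    ∃ κ : Kernel α α, IsMarkovKernel κ ∧ (∀ x, κ x ≪ μ) ∧
      ∀ x ∈ μ.support, ∀ᵐ x' ∂κ x, dist x' x < δ := by
  classical
  have : Nonempty μ.support := (Measure.nonempty_support hμ).to_subtype
  let u : ℕ → α := fun n => (TopologicalSpace.denseSeq μ.support n : α)
  let p : α → ℕ → Prop := fun x n => x ∈ ball (u n) (δ / 2) ∨ x ∈ μ.supportᶜ
  have hp : ∀ x, ∃ n, p x n := by
    intro x
    by_cases hx : x ∈ μ.support
    · obtain ⟨n, hn⟩ := (TopologicalSpace.denseRange_denseSeq μ.support).exists_dist_lt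
        (⟨x, hx⟩ : μ.support) (half_pos hδ)
      exact ⟨n, Or.inl hn⟩
    · exact ⟨0, Or.inr hx⟩
  have hi : Measurable fun x => Nat.find (hp x) :=
    measurable_find hp fun n =>
      measurableSet_ball.union Measure.isClosed_support.measurableSet.compl
  have hpos : ∀ n, μ (ball (u n) (δ / 2)) ≠ 0 := fun n =>
    ((Measure.mem_support_iff_forall _).1 (TopologicalSpace.denseSeq μ.support n).2 _
      (ball_mem_nhds _ (half_pos hδ))).ne'
  let κ₀ : Kernel ℕ α := Kernel.ofFunOfCountable fun n => μ[|ball (u n) (δ / 2)]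
  have : IsMarkovKernel κ₀ := ⟨fun n => cond_isProbabilityMeasure (hpos n)⟩
  refine ⟨κ₀.comap _ hi, inferInstance, fun x => ?_, fun x hx => ?_⟩
  · rw [Kernel.comap_apply]
    exact cond_absolutelyContinuous
  · rw [Kernel.comap_apply]
    have hx' : dist x (u (Nat.find (hp x))) < δ / 2 :=
      (Nat.find_spec (hp x)).resolve_right fun h => h hx
    filter_upwards [ae_cond_mem measurableSet_ball] with x' h
    have h' : dist x' (u (Nat.find (hp x))) < δ / 2 := h
    linarith [dist_triangle_right x' x (u (Nat.find (hp x)))]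

section ParallelCompId

variable {α β : Type*} [MeasurableSpace α] [MeasurableSpace β]

theorem parallelComp_id_apply (κ : Kernel α α) [IsMarkovKernel κ] (p : α × β) :
    (κ ∥ₖ (Kernel.id : Kernel β β)) p = (κ p.1).map fun x => (x, p.2) := by
  rw [Kernel.parallelComp_apply, Kernel.id_apply, Measure.prod_dirac]

theorem snd_bind_parallelComp_id (π : Measure (α × β)) (κ : Kernel α α) [IsMarkovKernel κ] :
    (π.bind (κ ∥ₖ (Kernel.id : Kernel β β))).snd = π.snd := by
  ext s hs
  rw [Measure.snd_apply hs, Measure.bind_apply (measurable_snd hs) (Kernel.aemeasurable _),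
    Measure.snd_apply hs, ← lintegral_indicator_one (measurable_snd hs)]
  refine lintegral_congr fun p => ?_
  rw [parallelComp_id_apply, Measure.map_apply (by fun_prop) (measurable_snd hs)]
  by_cases hp : p.2 ∈ s <;> simp [hp, preimage_preimage]

theorem fst_bind_parallelComp_id_absolutelyContinuous {μ : Measure α} (π : Measure (α × β))
    (κ : Kernel α α) [IsMarkovKernel κ] (hκ : ∀ x, κ x ≪ μ) :
    (π.bind (κ ∥ₖ (Kernel.id : Kernel β β))).fst ≪ μ := by
  refine Measure.AbsolutelyContinuous.mk fun s hs h => ?_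
  rw [Measure.fst_apply hs, Measure.bind_apply (measurable_fst hs) (Kernel.aemeasurable _)]
  refine (lintegral_congr fun p => ?_).trans lintegral_zero
  rw [parallelComp_id_apply, Measure.map_apply (by fun_prop) (measurable_fst hs)]
  simpa [preimage_preimage] using hκ p.1 h

theorem norm_integral_bind_parallelComp_id_sub_le (π : Measure (α × β)) [IsProbabilityMeasure π]
    (κ : Kernel α α) [IsMarkovKernel κ] {f : α × β → ℝ} (hf : Measurable f) {C : ℝ}
    (hC : ∀ p, ‖f p‖ ≤ C) {ε : ℝ}
    (h : ∀ᵐ p ∂π, ∀ᵐ x ∂κ p.1, ‖f (x, p.2) - f p‖ ≤ ε) :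
    ‖∫ p, f p ∂(π.bind (κ ∥ₖ (Kernel.id : Kernel β β))) - ∫ p, f p ∂π‖ ≤ ε := by
  have hint : ∀ (m : Measure (α × β)) [IsFiniteMeasure m], Integrable f m := fun m _ =>
    .of_bound hf.aestronglyMeasurable C (.of_forall hC)
  have hbind := hint (π.bind (κ ∥ₖ (Kernel.id : Kernel β β)))
  rw [← Kernel.const_apply (mα := PUnit.instMeasurableSpace) (π.bind _) (), ← Kernel.comp_const] at hbind ⊢
  rw [Kernel.integral_comp hbind, Kernel.const_apply, ← integral_sub]
  · refine (norm_integral_le_of_norm_le_const (C := ε) ?_).trans (by simp)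
    filter_upwards [h] with p hp
    have hfp : Measurable fun x => f (x, p.2) := by fun_prop
    have hc : f p = ∫ _, f p ∂κ p.1 := by simp
    rw [parallelComp_id_apply, integral_map (by fun_prop) hf.aestronglyMeasurable, hc,
      ← integral_sub (.of_bound hfp.aestronglyMeasurable C (.of_forall fun _ => hC _))
        (integrable_const _)]
    exact (norm_integral_le_of_norm_le_const hp).trans (by simp)
  · exact hbind.integral_comp
  · exact hint π

end ParallelCompId

theorem msupport_eq_support {Z : Type*} [TopologicalSpace Z] [MeasurableSpace Z]
    (μ : Measure Z) : msupport μ = μ.support := by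
  rw [Measure.support_eq_forall_isOpen]
  exact Set.ext fun x => forall_congr' fun U => forall_comm

theorem isClosed_setOf_apply_eq_one {Z : Type*} [TopologicalSpace Z] [MeasurableSpace Z]
    [OpensMeasurableSpace Z] [HasOuterApproxClosed Z] {F : Set Z} (hF : IsClosed F) :
    IsClosed {π : ProbabilityMeasure Z | (π : Measure Z) F = 1} := by
  refine isClosed_iff_forall_filter.2 fun π L _ hL hπ => ?_
  have h := ProbabilityMeasure.limsup_measure_closed_le_of_tendsto (μs := id) hπ hF
  refine le_antisymm prob_le_one (le_trans (le_of_eq ?_) h)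
  have h1 : ∀ᶠ π' : ProbabilityMeasure Z in L, ((id π' : ProbabilityMeasure Z) : Measure Z) F = 1 :=
    hL (mem_principal_self _)
  rw [limsup_congr h1, limsup_const]

theorem isClosed_setOf_memPiSupp {α β : Type*}
    [TopologicalSpace α] [PolishSpace α] [MeasurableSpace α] [BorelSpace α]
    [TopologicalSpace β] [PolishSpace β] [MeasurableSpace β] [BorelSpace β]
    (μ : Measure α) (ν : Measure β) [IsProbabilityMeasure ν] :
    IsClosed {π : ProbabilityMeasure (α × β) | MemPiSupp μ ν π} := by
  let _ := TopologicalSpace.upgradeIsCompletelyMetrizable α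
  let _ := TopologicalSpace.upgradeIsCompletelyMetrizable β
  have hS : IsClosed (msupport μ) := msupport_eq_support μ ▸ Measure.isClosed_support
  let ν' : ProbabilityMeasure β := ⟨ν, inferInstance⟩
  have h₁ := isClosed_setOf_apply_eq_one (hS.preimage (continuous_fst (Y := β)))
  have h₂ := isClosed_eq (ProbabilityMeasure.continuous_map (continuous_snd (X := α) (Y := β)))
    (continuous_const (y := ν'))
  convert h₁.inter h₂ using 1
  ext π
  refine and_congr ?_ (Subtype.ext_iff (a1 := π.map _) (a2 := ν')).symm
  rw [Measure.fst_apply hS.measurableSet]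
  rfl

theorem apply_msupport_eq_one_of_absolutelyContinuous {Z : Type*} [TopologicalSpace Z]
    [SecondCountableTopology Z] [MeasurableSpace Z] [OpensMeasurableSpace Z] {μ ρ : Measure Z}
    [IsProbabilityMeasure ρ] (h : ρ ≪ μ) : ρ (msupport μ) = 1 := by
  rw [msupport_eq_support, ← prob_compl_eq_zero_iff Measure.isClosed_support.measurableSet]
  exact h Measure.measure_compl_support

theorem mem_closure_setOf_memPiAC {α β : Type*}
    [TopologicalSpace α] [PolishSpace α] [CompactSpace α] [MeasurableSpace α] [BorelSpace α]
    [TopologicalSpace β] [PolishSpace β] [CompactSpace β] [MeasurableSpace β] [BorelSpace β]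
    {μ : Measure α} {ν : Measure β} [IsProbabilityMeasure μ] {π : ProbabilityMeasure (α × β)}
    (h : MemPiSupp μ ν π) : π ∈ closure {π : ProbabilityMeasure (α × β) | MemPiAC μ ν π} := by
  let _ := TopologicalSpace.upgradeIsCompletelyMetrizable α
  let _ := TopologicalSpace.upgradeIsCompletelyMetrizable β
  obtain ⟨δ, -, hδ, hlim⟩ := exists_seq_strictAnti_tendsto (0 : ℝ)
  choose κ hM hκ hd using fun n =>
    exists_markovKernel_absolutelyContinuous_dist_lt μ (IsProbabilityMeasure.ne_zero μ) (hδ n)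
  let ρ : ℕ → ProbabilityMeasure (α × β) := fun n =>
    ⟨(π : Measure (α × β)).bind (κ n ∥ₖ (Kernel.id : Kernel β β)), inferInstance⟩
  have hπS : ∀ᵐ p ∂(π : Measure (α × β)), p.1 ∈ μ.support := by
    have hS : MeasurableSet μ.support := Measure.isClosed_support.measurableSet
    have h1 := h.1
    rw [msupport_eq_support, Measure.fst_apply hS] at h1
    exact (prob_compl_eq_zero_iff (measurable_fst hS)).2 h1
  refine mem_closure_of_tendsto (f := ρ) (b := atTop) ?_ (.of_forall fun n =>
    ⟨fst_bind_parallelComp_id_absolutelyContinuous _ _ (hκ n),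
      (snd_bind_parallelComp_id _ _).trans h.2⟩)
  refine ProbabilityMeasure.tendsto_iff_forall_integral_tendsto.2 fun f => ?_
  refine Metric.tendsto_atTop.2 fun ε hε => ?_
  obtain ⟨η, hη, hf⟩ := Metric.uniformContinuous_iff.1
    (CompactSpace.uniformContinuous_of_continuous f.continuous) (ε / 2) (half_pos hε)
  obtain ⟨N, hN⟩ := eventually_atTop.1 (hlim.eventually_lt_const hη)
  refine ⟨N, fun n hn => lt_of_le_of_lt ?_ (half_lt_self hε)⟩
  rw [dist_eq_norm]
  refine norm_integral_bind_parallelComp_id_sub_le _ (κ n) f.continuous.measurable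
    f.norm_coe_le_norm ?_
  filter_upwards [hπS] with p hp
  filter_upwards [hd n p.1 hp] with x hx
  rw [← dist_eq_norm]
  refine (hf ?_).le
  rw [Prod.dist_eq]
  exact max_lt (hx.trans (hN n hn)) (by simpa using hη)

/-- Lemma `lem:descr`: the weak closure of `Π(≪ μ, ν)` in `P(X × Y)` is
`Π(Supp(μ), ν)`. -/
theorem closure_PiAC_eq_PiSupp
    [CompactSpace X] [CompactSpace Y]
    (μ : Measure X) (ν : Measure Y)
    [IsProbabilityMeasure μ] [IsProbabilityMeasure ν] :
    closure {π : ProbabilityMeasure (X × Y) | MemPiAC μ ν π} =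
      {π : ProbabilityMeasure (X × Y) | MemPiSupp μ ν π} := by
  refine Subset.antisymm ?_ fun π hπ => mem_closure_setOf_memPiAC hπ
  exact closure_minimal (fun π hπ =>
    ⟨apply_msupport_eq_one_of_absolutelyContinuous hπ.1, hπ.2⟩) (isClosed_setOf_memPiSupp μ ν)

end UWOT
end
end

section
/- Assume c satisfies Assumption (A). Then the functional P(X) × P(X×Y) → ℝ ∪ {+∞}, (μ,π) ↦ bar I_c^μ[π], is jointly lower semicontinuous, and bar I_c^μ[π] = I_c^μ[π] for every π ∈ P(X×Y) whose first marginal is absolutely continuous with respect to μ. -/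
open MeasureTheory ProbabilityTheory Topology Filter Set Metric
open scoped NNReal ENNReal

noncomputable section

namespace UWOT

variable {X Y : Type*}
  [TopologicalSpace X] [PolishSpace X] [MeasurableSpace X] [BorelSpace X]
  [TopologicalSpace Y] [PolishSpace Y] [MeasurableSpace Y] [BorelSpace Y]

variable [Nonempty Y]

set_option linter.unusedSectionVars false

section Analysis

variable {α : Type*} [MeasurableSpace α] {ρ σ : Measure α}

lemma epos_eq_toENNReal : epos = EReal.toENNReal := rfl

lemma eintegral_congr_ae {f g : α → EReal} (h : f =ᵐ[ρ] g) : eintegral ρ f = eintegral ρ g := by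
  have h₁ : ∫⁻ x, epos (f x) ∂ρ = ∫⁻ x, epos (g x) ∂ρ :=
    lintegral_congr_ae (h.mono fun x hx => by simp only [hx])
  have h₂ : ∫⁻ x, epos (-(f x)) ∂ρ = ∫⁻ x, epos (-(g x)) ∂ρ :=
    lintegral_congr_ae (h.mono fun x hx => by simp only [hx])
  rw [eintegral, eintegral, h₁, h₂]

lemma eintegral_zero_measure (f : α → EReal) : eintegral (0 : Measure α) f = 0 := by
  simp [eintegral]

lemma eintegral_mono {f g : α → EReal} (h : ∀ x, f x ≤ g x) : eintegral ρ f ≤ eintegral ρ g := by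
  refine EReal.sub_le_sub ?_ ?_ <;> refine EReal.coe_ennreal_le_coe_ennreal_iff.2 <|
    lintegral_mono fun x => EReal.toENNReal_le_toENNReal ?_
  · exact h x
  · exact EReal.neg_le_neg_iff.2 (h x)

lemma eintegral_add_measure {f : α → EReal} (h : ∫⁻ x, epos (-(f x)) ∂(ρ + σ) ≠ ⊤) :
    eintegral (ρ + σ) f = eintegral ρ f + eintegral σ f := by
  rw [lintegral_add_measure, ENNReal.add_ne_top] at h
  simp only [eintegral, lintegral_add_measure, EReal.coe_ennreal_add]
  refine EReal.add_sub_add_comm (.inl (EReal.coe_ennreal_ne_bot _)) (.inl ?_)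
  exact fun h' => h.1 (EReal.coe_ennreal_eq_top_iff.1 h')

lemma eintegral_coe {f : α → ℝ} (hf : Integrable f ρ) :
    eintegral ρ (fun x => (f x : EReal)) = ((∫ x, f x ∂ρ : ℝ) : EReal) := by
  have hpos : ∫⁻ x, ENNReal.ofReal (f x) ∂ρ ≠ ⊤ := hf.lintegral_lt_top.ne
  have hneg : ∫⁻ x, ENNReal.ofReal (-f x) ∂ρ ≠ ⊤ := hf.neg.lintegral_lt_top.ne
  rw [integral_eq_lintegral_pos_part_sub_lintegral_neg_part hf, EReal.coe_sub,
    EReal.coe_ennreal_toReal hpos, EReal.coe_ennreal_toReal hneg, eintegral]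
  simp [epos_eq_toENNReal, ← EReal.coe_neg]

lemma lintegral_epos_neg_ne_top {f : α → ℝ} {g : α → EReal} (hf : Integrable f ρ)
    (h : ∀ x, (f x : EReal) ≤ g x) : ∫⁻ x, epos (-(g x)) ∂ρ ≠ ⊤ := by
  refine ((lintegral_mono fun x => ?_).trans_lt hf.neg.lintegral_lt_top).ne
  refine (EReal.toENNReal_le_toENNReal (EReal.neg_le_neg_iff.2 (h x))).trans ?_
  simp [← EReal.coe_neg]

/-- Monotone convergence for `eintegral`. -/
lemma tendsto_integral_eintegral {f : ℕ → α → ℝ} {g : α → EReal} (hf : ∀ n, Integrable (f n) ρ)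
    (hmono : Monotone f)
    (hlim : ∀ x, Tendsto (fun n => (f n x : EReal)) atTop (𝓝 (g x))) :
    Tendsto (fun n => ((∫ x, f n x ∂ρ : ℝ) : EReal)) atTop (𝓝 (eintegral ρ g)) := by
  have hle : ∀ x, (f 0 x : EReal) ≤ g x := fun x =>
    ge_of_tendsto' (hlim x) fun n => EReal.coe_le_coe_iff.2 (hmono n.zero_le x)
  have hneg := lintegral_epos_neg_ne_top (hf 0) hle
  have hcont := EReal.continuous_toENNReal
  have h₁ : Tendsto (fun n => ∫⁻ x, epos (f n x) ∂ρ) atTop (𝓝 (∫⁻ x, epos (g x) ∂ρ)) := by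
    refine lintegral_tendsto_of_tendsto_of_monotone (fun n => ?_) (.of_forall fun x m n hmn => ?_)
      (.of_forall fun x => (hcont.tendsto _).comp (hlim x))
    · simpa [epos_eq_toENNReal] using (hf n).1.aemeasurable.ennreal_ofReal
    · exact EReal.toENNReal_le_toENNReal (EReal.coe_le_coe_iff.2 (hmono hmn x))
  have h₂ : Tendsto (fun n => ∫⁻ x, epos (-(f n x : EReal)) ∂ρ) atTop
      (𝓝 (∫⁻ x, epos (-(g x)) ∂ρ)) := by
    refine lintegral_tendsto_of_tendsto_of_antitone (fun n => ?_)
      (.of_forall fun x m n hmn => ?_) (lintegral_epos_neg_ne_top (hf 0) fun _ => le_rfl)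
      (.of_forall fun x => (hcont.tendsto _).comp ((continuous_neg.tendsto _).comp (hlim x)))
    · simpa [epos_eq_toENNReal, ← EReal.coe_neg] using (hf n).1.aemeasurable.neg.ennreal_ofReal
    · exact EReal.toENNReal_le_toENNReal
        (EReal.neg_le_neg_iff.2 (EReal.coe_le_coe_iff.2 (hmono hmn x)))
  simp_rw [← eintegral_coe (hf _)]
  refine (EReal.continuousAt_add (p := (_, _)) (.inr ?_) (.inl ?_)).tendsto.comp
    (Tendsto.prodMk_nhds ((continuous_coe_ennreal_ereal.tendsto _).comp h₁)
    ((continuous_neg.tendsto _).comp ((continuous_coe_ennreal_ereal.tendsto _).comp h₂)))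
  · simpa using hneg
  · exact EReal.coe_ennreal_ne_bot _

end Analysis



/-- The pointwise maximum of two integrable functions is approximated in `L¹` by
interpolating between them with a continuous weight. -/
lemma exists_continuous_interpolation_near_sup {ρ : Measure X} [IsFiniteMeasure ρ] {u v : X → ℝ}
    (hu : Integrable u ρ) (hv : Integrable v ρ) (hum : Measurable u) (hvm : Measurable v)
    {ε : ℝ≥0∞} (hε : ε ≠ 0) :
    ∃ f : C(X, ℝ), (∀ x, f x ∈ Icc (0 : ℝ) 1) ∧
      ∫⁻ x, ‖(u x + f x * (v x - u x)) - (u x ⊔ v x)‖ₑ ∂ρ ≤ ε := by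
  set B : Set X := {x | u x < v x}
  have hB : MeasurableSet B := measurableSet_lt hum hvm
  have hw : Measurable fun x => ‖v x - u x‖ₑ := (hvm.sub hum).enorm
  set τ := ρ.withDensity fun x => ‖v x - u x‖ₑ
  have : IsFiniteMeasure τ := isFiniteMeasure_withDensity (hv.sub hu).2.ne
  have hB₁ : MemLp (B.indicator fun _ => (1 : ℝ)) 1 τ :=
    memLp_indicator_const 1 hB 1 (.inr (measure_ne_top _ _))
  obtain ⟨g, hg, -⟩ := hB₁.exists_boundedContinuous_eLpNorm_sub_le ENNReal.one_ne_top hε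
  rw [eLpNorm_one_eq_lintegral_enorm] at hg
  refine ⟨⟨fun x => (g x ⊔ 0) ⊓ 1, by fun_prop⟩, fun x => ⟨by simp, by simp⟩, ?_⟩
  rw [lintegral_withDensity_eq_lintegral_mul _ hw
    (((measurable_const.indicator hB).sub g.continuous.measurable).enorm)] at hg
  refine (lintegral_mono fun x => ?_).trans hg
  have hclamp : ∀ t : ℝ, t ∈ Icc (0 : ℝ) 1 → |(g x ⊔ 0) ⊓ 1 - t| ≤ |t - g x| := by
    rintro t ⟨h0, h1⟩
    rw [abs_sub_comm t]
    rcases le_total (g x) 0 with h | h <;> rcases le_total (g x) 1 with h' | h' <;>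
      simp only [sup_of_le_left, sup_of_le_right, inf_of_le_left, inf_of_le_right, zero_le_one, *]
      <;> rw [abs_le] <;> constructor <;> cases abs_cases (g x - t) <;> linarith
  have hid : (u x + ((g x ⊔ 0) ⊓ 1) * (v x - u x)) - (u x ⊔ v x)
      = (v x - u x) * ((g x ⊔ 0) ⊓ 1 - B.indicator (fun _ => (1 : ℝ)) x) := by
    by_cases hx : u x < v x
    · simp only [B, indicator, mem_ofPred_eq, hx, if_true, sup_of_le_right hx.le]; ring
    · simp only [B, indicator, mem_ofPred_eq, hx, if_false, sup_of_le_left (not_lt.1 hx)]; ring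
  simp only [ContinuousMap.coe_mk, hid, Pi.mul_apply, Pi.sub_apply, enorm_mul]
  gcongr
  rw [Real.enorm_eq_ofReal_abs, Real.enorm_eq_ofReal_abs]
  refine ENNReal.ofReal_le_ofReal (hclamp _ ?_)
  by_cases hx : x ∈ B <;> simp [hx]

section Dual

variable {c : X → FiniteMeasure Y → ℝ} {a : ℕ → C(X, ℝ)} {b : ℕ → C(X × Y, ℝ)}

lemma integral_smul_finiteMeasure (f : Y → ℝ) (t : ℝ≥0) (m : FiniteMeasure Y) :
    ∫ y, f y ∂((t • m : FiniteMeasure Y) : Measure Y) = t * ∫ y, f y ∂(m : Measure Y) := by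
  rw [FiniteMeasure.toMeasure_smul, integral_smul_nnreal_measure, NNReal.smul_def, smul_eq_mul]

/-- The recession function of a supremum of affine functions is the supremum of the
linear parts. -/
lemma isLUB_recession
    (hab : ∀ (x : X) (m : FiniteMeasure Y),
      IsLUB (range fun k => (∫ y, b k (x, y) ∂(m : Measure Y)) + a k x) (c x m))
    (x : X) (m : FiniteMeasure Y) :
    IsLUB (range fun k => ((∫ y, b k (x, y) ∂(m : Measure Y) : ℝ) : EReal))
      (recession c x m) := by
  have hdiv : ∀ r : ℝ, Tendsto (fun lam : ℝ≥0 => r / (lam : ℝ)) atTop (𝓝 0) := fun r =>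
    tendsto_const_nhds.div_atTop (NNReal.tendsto_coe_atTop.2 tendsto_id)
  constructor
  · rintro _ ⟨k, rfl⟩
    have hlim : Tendsto (fun lam : ℝ≥0 =>
        (((∫ y, b k (x, y) ∂(m : Measure Y)) + a k x / (lam : ℝ) : ℝ) : EReal)) atTop
        (𝓝 ((∫ y, b k (x, y) ∂(m : Measure Y) : ℝ) : EReal)) := by
      refine (continuous_coe_real_ereal.tendsto _).comp ?_
      simpa using (hdiv (a k x)).const_add (∫ y, b k (x, y) ∂(m : Measure Y))
    dsimp only
    rw [recession, ← hlim.limsup_eq]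
    refine limsup_le_limsup ?_
    filter_upwards [eventually_gt_atTop 0] with lam hlam
    have hlam' : (0 : ℝ) < lam := hlam
    rw [EReal.coe_le_coe_iff, le_div_iff₀ hlam', add_mul, div_mul_cancel₀ _ hlam'.ne', mul_comm,
      ← integral_smul_finiteMeasure]
    exact (hab x (lam • m)).1 ⟨k, rfl⟩
  · intro M hM
    induction M with
    | top => exact le_top
    | bot => simpa using hM ⟨0, rfl⟩
    | coe M =>
      have hM' : ∀ k, ∫ y, b k (x, y) ∂(m : Measure Y) ≤ M := fun k =>
        EReal.coe_le_coe_iff.1 (hM ⟨k, rfl⟩)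
      have hlim : Tendsto (fun lam : ℝ≥0 => ((M + c x 0 / (lam : ℝ) : ℝ) : EReal)) atTop
          (𝓝 (M : EReal)) := by
        refine (continuous_coe_real_ereal.tendsto _).comp ?_
        simpa using (hdiv (c x 0)).const_add M
      rw [recession, ← hlim.limsup_eq]
      refine limsup_le_limsup ?_
      filter_upwards [eventually_gt_atTop 0] with lam hlam
      have hlam' : (0 : ℝ) < lam := hlam
      rw [EReal.coe_le_coe_iff, div_le_iff₀ hlam', add_mul, div_mul_cancel₀ _ hlam'.ne']
      refine (hab x (lam • m)).2 ?_
      rintro _ ⟨k, rfl⟩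
      have h0 : a k x ≤ c x 0 := by simpa using (hab x 0).1 ⟨k, rfl⟩
      simp only [integral_smul_finiteMeasure]
      have := mul_le_mul_of_nonneg_left (hM' k) hlam'.le
      linarith

/-- The pairs `(α, β)` for which the affine function `m ↦ t α(x) + ∫ β(x, ·) dm` lies, for every
`x` and every `t`, below the supremum of those given by `a k`, `b k`. -/
def SubAffine (a : ℕ → C(X, ℝ)) (b : ℕ → C(X × Y, ℝ)) (e : C(X, ℝ) × C(X × Y, ℝ)) : Prop :=
  ∀ (x : X) (m : FiniteMeasure Y) (t M : ℝ),
    (∀ k, t * a k x + ∫ y, b k (x, y) ∂(m : Measure Y) ≤ M) →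
      t * e.1 x + ∫ y, e.2 (x, y) ∂(m : Measure Y) ≤ M

/-- Interpolation of two pairs with a continuous weight on `X`. -/
def interpolate (f : C(X, ℝ)) (e e' : C(X, ℝ) × C(X × Y, ℝ)) : C(X, ℝ) × C(X × Y, ℝ) :=
  (e.1 + f * (e'.1 - e.1), e.2 + f.comp ContinuousMap.fst * (e'.2 - e.2))

variable [CompactSpace Y]

lemma integrable_continuousMap_section (β : C(X × Y, ℝ)) (x : X) (m : Measure Y)
    [IsFiniteMeasure m] : Integrable (fun y => β (x, y)) m :=
  (BoundedContinuousFunction.mkOfCompact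
    (β.comp ((ContinuousMap.const Y x).prodMk (ContinuousMap.id Y)))).integrable m

lemma interpolate_apply (f : C(X, ℝ)) (e e' : C(X, ℝ) × C(X × Y, ℝ)) (x : X)
    (m : Measure Y) [IsFiniteMeasure m] (s t : ℝ) :
    t * (interpolate f e e').1 x + s * ∫ y, (interpolate f e e').2 (x, y) ∂m =
      (t * e.1 x + s * ∫ y, e.2 (x, y) ∂m) + f x * ((t * e'.1 x + s * ∫ y, e'.2 (x, y) ∂m) -
        (t * e.1 x + s * ∫ y, e.2 (x, y) ∂m)) := by
  have he := integrable_continuousMap_section e.2 x m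
  have he' := integrable_continuousMap_section e'.2 x m
  have : ∫ y, (interpolate f e e').2 (x, y) ∂m =
      (∫ y, e.2 (x, y) ∂m) + f x * ((∫ y, e'.2 (x, y) ∂m) - ∫ y, e.2 (x, y) ∂m) := by
    have hd : Integrable (fun y => f x * (e'.2 (x, y) - e.2 (x, y))) m :=
      (he'.sub he).const_mul _
    rw [← integral_sub he' he, ← integral_const_mul, ← integral_add he hd]
    rfl
  rw [this]
  simp only [interpolate, ContinuousMap.add_apply, ContinuousMap.mul_apply,
    ContinuousMap.sub_apply]
  ring

lemma SubAffine.interpolate {e e' : C(X, ℝ) × C(X × Y, ℝ)} (he : SubAffine a b e)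
    (he' : SubAffine a b e') {f : C(X, ℝ)} (hf : ∀ x, f x ∈ Icc (0 : ℝ) 1) :
    SubAffine a b (interpolate f e e') := by
  intro x m t M hM
  have h := interpolate_apply f e e' x (m : Measure Y) 1 t
  simp only [one_mul] at h
  rw [h]
  have h₁ := he x m t M hM
  have h₂ := he' x m t M hM
  obtain ⟨hf0, hf1⟩ := hf x
  nlinarith

/-- A measurable set carrying `μ` and negligible for the singular part of the first marginal
of `π`. -/
def regularSet (μ : Measure X) (π : ProbabilityMeasure (X × Y)) : Set X :=
  (Measure.mutuallySingular_singularPart (π : Measure (X × Y)).fst μ).nullSet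

/-- The sum of `μ` and of the singular part of the first marginal of `π`. -/
def totalMeasure (μ : Measure X) (π : ProbabilityMeasure (X × Y)) : Measure X :=
  μ + (π : Measure (X × Y)).fst.singularPart μ

open Classical in
/-- The density of the first marginal of `π` with respect to `totalMeasure μ π`. -/
def marginalDensity (μ : Measure X) (π : ProbabilityMeasure (X × Y)) (x : X) : ℝ≥0 :=
  if x ∈ regularSet μ π then ((π : Measure (X × Y)).fst.rnDeriv μ x).toNNReal else 1

open Classical in
/-- The common integrand of the two terms of `barI`. -/
def barIntegrand (c : X → FiniteMeasure Y → ℝ) (μ : Measure X) (π : ProbabilityMeasure (X × Y))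
    (x : X) : EReal :=
  if x ∈ regularSet μ π then (c x (fiber μ π x) : EReal) else recession c x (condFM π x)

/-- The density with respect to `totalMeasure μ π` of `(μ, π) ↦ ∫ α dμ + ∫ β dπ`. -/
def affineIntegrand (μ : Measure X) (π : ProbabilityMeasure (X × Y))
    (e : C(X, ℝ) × C(X × Y, ℝ)) (x : X) : ℝ :=
  (regularSet μ π).indicator 1 x * e.1 x +
    marginalDensity μ π x * ∫ y, e.2 (x, y) ∂(condFM π x : Measure Y)

lemma isLUB_coe_ereal {s : ℕ → ℝ} {z : ℝ} (h : IsLUB (range s) z) :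
    IsLUB (range fun k => (s k : EReal)) (z : EReal) := by
  constructor
  · rintro _ ⟨k, rfl⟩
    exact EReal.coe_le_coe_iff.2 (h.1 ⟨k, rfl⟩)
  · intro M hM
    induction M with
    | top => exact le_top
    | bot => simpa using hM ⟨0, rfl⟩
    | coe M =>
      refine EReal.coe_le_coe_iff.2 (h.2 ?_)
      rintro _ ⟨k, rfl⟩
      exact EReal.coe_le_coe_iff.1 (hM ⟨k, rfl⟩)

section Integrand

variable {μ : Measure X} {π : ProbabilityMeasure (X × Y)}

lemma measurableSet_regularSet : MeasurableSet (regularSet μ π) :=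
  Measure.MutuallySingular.measurableSet_nullSet _

lemma ae_mem_regularSet : ∀ᵐ x ∂μ, x ∈ regularSet μ π :=
  Measure.MutuallySingular.measure_compl_nullSet
    (Measure.mutuallySingular_singularPart (π : Measure (X × Y)).fst μ)

lemma ae_notMem_regularSet :
    ∀ᵐ x ∂((π : Measure (X × Y)).fst.singularPart μ), x ∉ regularSet μ π :=
  measure_eq_zero_iff_ae_notMem.1 (Measure.MutuallySingular.measure_nullSet
    (Measure.mutuallySingular_singularPart (π : Measure (X × Y)).fst μ))

instance [IsFiniteMeasure μ] : IsFiniteMeasure (totalMeasure μ π) :=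
  inferInstanceAs (IsFiniteMeasure (_ + _))

lemma affineIntegrand_of_mem {x : X} (hx : x ∈ regularSet μ π) (e : C(X, ℝ) × C(X × Y, ℝ)) :
    affineIntegrand μ π e x = e.1 x + ((π : Measure (X × Y)).fst.rnDeriv μ x).toReal *
      ∫ y, e.2 (x, y) ∂((π : Measure (X × Y)).condKernel x) := by
  simp only [affineIntegrand, marginalDensity, hx, indicator_of_mem, if_true, Pi.one_apply,
    one_mul]
  rfl

lemma affineIntegrand_of_notMem {x : X} (hx : x ∉ regularSet μ π)
    (e : C(X, ℝ) × C(X × Y, ℝ)) :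
    affineIntegrand μ π e x = ∫ y, e.2 (x, y) ∂((π : Measure (X × Y)).condKernel x) := by
  simp only [affineIntegrand, marginalDensity, hx, not_false_eq_true, indicator_of_notMem,
    if_false, zero_mul, zero_add, NNReal.coe_one, one_mul]
  rfl

lemma isLUB_barIntegrand
    (hab : ∀ (x : X) (m : FiniteMeasure Y),
      IsLUB (range fun k => (∫ y, b k (x, y) ∂(m : Measure Y)) + a k x) (c x m)) (x : X) :
    IsLUB (range fun k => (affineIntegrand μ π (a k, b k) x : EReal)) (barIntegrand c μ π x) := by
  by_cases hx : x ∈ regularSet μ π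
  · simp only [barIntegrand, if_pos hx, affineIntegrand_of_mem hx]
    convert isLUB_coe_ereal (hab x (fiber μ π x)) using 4 with k
    rw [fiber, integral_smul_finiteMeasure, add_comm]
    rfl
  · simp only [barIntegrand, if_neg hx, affineIntegrand_of_notMem hx]
    exact isLUB_recession hab x (condFM π x)

lemma SubAffine.affineIntegrand_le_barIntegrand
    (hab : ∀ (x : X) (m : FiniteMeasure Y),
      IsLUB (range fun k => (∫ y, b k (x, y) ∂(m : Measure Y)) + a k x) (c x m))
    {e : C(X, ℝ) × C(X × Y, ℝ)} (he : SubAffine a b e) (x : X) :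
    (affineIntegrand μ π e x : EReal) ≤ barIntegrand c μ π x := by
  have hlub := (isLUB_barIntegrand (μ := μ) (π := π) hab x).1
  generalize barIntegrand c μ π x = M at hlub
  induction M with
  | top => exact le_top
  | bot => simpa using hlub ⟨0, rfl⟩
  | coe M =>
    rw [EReal.coe_le_coe_iff, affineIntegrand, ← integral_smul_finiteMeasure]
    refine he x _ _ M fun k => ?_
    rw [integral_smul_finiteMeasure]
    exact EReal.coe_le_coe_iff.1 (hlub ⟨k, rfl⟩)

lemma measurable_integral_condKernel (β : C(X × Y, ℝ)) :
    Measurable fun x => ∫ y, β (x, y) ∂((π : Measure (X × Y)).condKernel x) :=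
  (StronglyMeasurable.integral_kernel_prod_right'
    β.continuous.measurable.stronglyMeasurable).measurable

lemma measurable_affineIntegrand (e : C(X, ℝ) × C(X × Y, ℝ)) :
    Measurable (affineIntegrand μ π e) := by
  have hw : Measurable fun x => (marginalDensity μ π x : ℝ) :=
    (Measurable.ite measurableSet_regularSet (Measure.measurable_rnDeriv _ _).ennreal_toNNReal
      measurable_const).coe_nnreal_real
  exact ((measurable_one.indicator measurableSet_regularSet).mul e.1.continuous.measurable).add
    (hw.mul (measurable_integral_condKernel e.2))

variable [CompactSpace X]

lemma integrable_integral_condKernel (β : C(X × Y, ℝ)) (σ : Measure X) [IsFiniteMeasure σ] :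
    Integrable (fun x => ∫ y, β (x, y) ∂((π : Measure (X × Y)).condKernel x)) σ := by
  refine .of_bound (measurable_integral_condKernel β).aestronglyMeasurable ‖β‖
    (.of_forall fun x => ?_)
  simpa using norm_integral_le_of_norm_le_const
    (μ := (π : Measure (X × Y)).condKernel x) (.of_forall fun y => β.norm_coe_le_norm (x, y))

lemma integrable_and_integral_affineIntegrand [IsFiniteMeasure μ] (e : C(X, ℝ) × C(X × Y, ℝ)) :
    Integrable (affineIntegrand μ π e) (totalMeasure μ π) ∧
      ∫ x, affineIntegrand μ π e x ∂(totalMeasure μ π) =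
        ∫ x, e.1 x ∂μ + ∫ z, e.2 z ∂(π : Measure (X × Y)) := by
  set σ := (π : Measure (X × Y)).fst
  set J : X → ℝ := fun x => ∫ y, e.2 (x, y) ∂((π : Measure (X × Y)).condKernel x) with hJ
  have hα : Integrable e.1 μ := (BoundedContinuousFunction.mkOfCompact e.1).integrable μ
  have hβ : Integrable e.2 (π : Measure (X × Y)) :=
    (BoundedContinuousFunction.mkOfCompact e.2).integrable _
  have hdens : Integrable J (μ.withDensity (σ.rnDeriv μ)) :=
    have := isFiniteMeasure_withDensity (Measure.lintegral_rnDeriv_lt_top σ μ).ne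
    integrable_integral_condKernel _ _
  have hr : Integrable (fun x => (σ.rnDeriv μ x).toReal * J x) μ :=
    (integrable_withDensity_iff_integrable_smul' (Measure.measurable_rnDeriv _ _)
      (Measure.rnDeriv_lt_top σ μ)).1 hdens
  have hs : Integrable J (σ.singularPart μ) := integrable_integral_condKernel _ _
  have h₁ : affineIntegrand μ π e =ᵐ[μ] fun x => e.1 x + (σ.rnDeriv μ x).toReal * J x :=
    ae_mem_regularSet.mono fun x hx => affineIntegrand_of_mem hx e
  have h₂ : affineIntegrand μ π e =ᵐ[σ.singularPart μ] J :=
    ae_notMem_regularSet.mono fun x hx => affineIntegrand_of_notMem hx e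
  have hi₁ := (hα.add hr).congr h₁.symm
  have hi₂ := hs.congr h₂.symm
  refine ⟨hi₁.add_measure hi₂, ?_⟩
  rw [totalMeasure, integral_add_measure hi₁ hi₂, integral_congr_ae h₁, integral_congr_ae h₂,
    integral_add hα hr, add_assoc, ← Measure.integral_condKernel hβ]
  congr 1
  change _ = ∫ x, J x ∂σ
  conv_rhs => rw [← Measure.rnDeriv_add_singularPart σ μ]
  rw [integral_add_measure hdens hs, integral_withDensity_eq_integral_toReal_smul
    (Measure.measurable_rnDeriv _ _) (Measure.rnDeriv_lt_top σ μ)]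
  rfl

lemma barI_eq_eintegral [IsFiniteMeasure μ]
    (hab : ∀ (x : X) (m : FiniteMeasure Y),
      IsLUB (range fun k => (∫ y, b k (x, y) ∂(m : Measure Y)) + a k x) (c x m)) :
    barI c μ π = eintegral (totalMeasure μ π) (barIntegrand c μ π) := by
  have h := lintegral_epos_neg_ne_top
    (integrable_and_integral_affineIntegrand (μ := μ) (π := π) (a 0, b 0)).1
    fun x => (isLUB_barIntegrand hab x).1 ⟨0, rfl⟩
  rw [totalMeasure, eintegral_add_measure h, barI, eintegralR]
  congr 1 <;> refine (eintegral_congr_ae ?_).symm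
  · exact ae_mem_regularSet.mono fun x hx => if_pos hx
  · exact ae_notMem_regularSet.mono fun x hx => if_neg hx

/-- The functional `(μ, π) ↦ ∫ α dμ + ∫ β dπ` is a lower bound for `barI`. -/
lemma SubAffine.le_barI [IsFiniteMeasure μ]
    (hab : ∀ (x : X) (m : FiniteMeasure Y),
      IsLUB (range fun k => (∫ y, b k (x, y) ∂(m : Measure Y)) + a k x) (c x m))
    {e : C(X, ℝ) × C(X × Y, ℝ)} (he : SubAffine a b e) :
    ((∫ x, e.1 x ∂μ + ∫ z, e.2 z ∂(π : Measure (X × Y)) : ℝ) : EReal) ≤ barI c μ π := by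
  obtain ⟨hint, heq⟩ := integrable_and_integral_affineIntegrand (μ := μ) (π := π) e
  rw [barI_eq_eintegral hab, ← heq, ← eintegral_coe hint]
  exact eintegral_mono (he.affineIntegrand_le_barIntegrand hab)

lemma integrable_partialSups_affineIntegrand [IsFiniteMeasure μ] (n : ℕ) :
    Integrable (partialSups (fun k => affineIntegrand μ π (a k, b k)) n) (totalMeasure μ π) := by
  induction n with
  | zero => simpa using (integrable_and_integral_affineIntegrand (a 0, b 0)).1
  | succ n ih =>
    rw [← Order.succ_eq_add_one, partialSups_succ]
    exact ih.sup (integrable_and_integral_affineIntegrand _).1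

lemma exists_subAffine_near_partialSups [IsFiniteMeasure μ] (n : ℕ) {ε : ℝ≥0∞} (hε : ε ≠ 0) :
    ∃ e, SubAffine a b e ∧ ∫⁻ x, ‖affineIntegrand μ π e x -
      partialSups (fun k => affineIntegrand μ π (a k, b k)) n x‖ₑ ∂(totalMeasure μ π) ≤ ε := by
  have hab : ∀ k, SubAffine a b (a k, b k) := fun k x m t M hM => hM k
  induction n generalizing ε with
  | zero => exact ⟨(a 0, b 0), hab 0, by simp⟩
  | succ n ih =>
    have hε₂ : ε / 2 ≠ 0 := (ENNReal.half_pos hε).ne'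
    obtain ⟨e, he, hen⟩ := ih hε₂
    set e' := (a (n + 1), b (n + 1)) with he'
    have hmeas : ∀ e, Measurable (affineIntegrand μ π e) := measurable_affineIntegrand
    obtain ⟨f, hf, hfn⟩ := exists_continuous_interpolation_near_sup
      (integrable_and_integral_affineIntegrand (μ := μ) (π := π) e).1
      (integrable_and_integral_affineIntegrand (μ := μ) (π := π) e').1 (hmeas e) (hmeas e') hε₂
    refine ⟨interpolate f e e', he.interpolate (hab _) hf, ?_⟩
    rw [← ENNReal.add_halves ε]
    refine le_trans ?_ (add_le_add hfn hen)
    have hdiff := (((hmeas e).add (f.continuous.measurable.mul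
      ((hmeas e').sub (hmeas e)))).sub ((hmeas e).sup (hmeas e'))).enorm
    refine le_trans (lintegral_mono fun x => ?_) (lintegral_add_left hdiff _).le
    have hi : affineIntegrand μ π (interpolate f e e') x = affineIntegrand μ π e x +
        f x * (affineIntegrand μ π e' x - affineIntegrand μ π e x) :=
      interpolate_apply f e e' x _ _ _
    rw [← Order.succ_eq_add_one, partialSups_succ, hi, Pi.sup_apply, Order.succ_eq_add_one, ← he']
    simp only [Real.enorm_eq_ofReal_abs, Pi.add_apply, Pi.sub_apply, Pi.mul_apply, Pi.sup_apply]
    rw [← ENNReal.ofReal_add (abs_nonneg _) (abs_nonneg _)]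
    refine ENNReal.ofReal_le_ofReal ((abs_sub_le _ _ _).trans (add_le_add_right ?_ _))
    exact abs_max_sub_max_le_abs _ _ _

lemma tendsto_integral_partialSups_affineIntegrand [IsFiniteMeasure μ]
    (hab : ∀ (x : X) (m : FiniteMeasure Y),
      IsLUB (range fun k => (∫ y, b k (x, y) ∂(m : Measure Y)) + a k x) (c x m)) :
    Tendsto (fun n => ((∫ x, partialSups (fun k => affineIntegrand μ π (a k, b k)) n x
      ∂(totalMeasure μ π) : ℝ) : EReal)) atTop (𝓝 (barI c μ π)) := by
  set s : ℕ → X → ℝ := fun k => affineIntegrand μ π (a k, b k)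
  rw [barI_eq_eintegral hab]
  refine tendsto_integral_eintegral integrable_partialSups_affineIntegrand
    (partialSups_monotone s) fun x => tendsto_atTop_isLUB
      (fun m n h => EReal.coe_le_coe_iff.2 (partialSups_monotone s h x)) ⟨?_, fun M hM => ?_⟩
  · rintro _ ⟨n, rfl⟩
    dsimp only
    induction n with
    | zero => simpa using (isLUB_barIntegrand hab x).1 ⟨0, rfl⟩
    | succ n ih =>
      rw [← Order.succ_eq_add_one, partialSups_succ, Pi.sup_apply]
      rcases max_choice (partialSups s n x) (s (Order.succ n) x) with h | h <;> rw [h]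
      · exact ih
      · exact (isLUB_barIntegrand hab x).1 ⟨n + 1, rfl⟩
  · refine (isLUB_barIntegrand hab x).2 ?_
    rintro _ ⟨k, rfl⟩
    exact (EReal.coe_le_coe_iff.2 (le_partialSups s k x)).trans (hM ⟨k, rfl⟩)

/-- `barI` is the supremum of the functionals given by `SubAffine` pairs. -/
lemma exists_subAffine_lt_of_lt_barI [IsFiniteMeasure μ]
    (hab : ∀ (x : X) (m : FiniteMeasure Y),
      IsLUB (range fun k => (∫ y, b k (x, y) ∂(m : Measure Y)) + a k x) (c x m))
    {z : EReal} (hz : z < barI c μ π) :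
    ∃ e, SubAffine a b e ∧
      z < ((∫ x, e.1 x ∂μ + ∫ z, e.2 z ∂(π : Measure (X × Y)) : ℝ) : EReal) := by
  obtain ⟨n, hn⟩ :=
    ((tendsto_integral_partialSups_affineIntegrand hab).eventually (lt_mem_nhds hz)).exists
  obtain ⟨r, hzr, hrn⟩ := EReal.lt_iff_exists_real_btwn.1 hn
  rw [EReal.coe_lt_coe_iff] at hrn
  obtain ⟨e, he, hen⟩ := exists_subAffine_near_partialSups (μ := μ) (π := π) (a := a) (b := b) n
    (ENNReal.ofReal_pos.2 (sub_pos.2 hrn)).ne'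
  obtain ⟨hint, heq⟩ := integrable_and_integral_affineIntegrand (μ := μ) (π := π) e
  refine ⟨e, he, hzr.trans_le (EReal.coe_le_coe_iff.2 ?_)⟩
  have h := (enorm_integral_le_lintegral_enorm _).trans hen
  rw [integral_sub hint (integrable_partialSups_affineIntegrand n), Real.enorm_eq_ofReal_abs,
    ENNReal.ofReal_le_ofReal_iff (sub_pos.2 hrn).le, heq] at h
  linarith [(abs_le.1 h).1]

end Integrand

end Dual

/-- Proposition `prop:barI_csci`: under Assumption (A), the functional
`(μ, π) ↦ bar I_c^μ[π]` is jointly lower semicontinuous on `P(X) × P(X × Y)`, and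
`bar I_c^μ[π] = I_c^μ[π]` whenever the first marginal of `π` is absolutely continuous
with respect to `μ`. -/
theorem barI_lowerSemicontinuous_and_eq_Icmu
    [CompactSpace X] [CompactSpace Y]
    (c : X → FiniteMeasure Y → ℝ) (hc : IsCost c) (hA : AssumpA c) :
    LowerSemicontinuous
      (fun p : ProbabilityMeasure X × ProbabilityMeasure (X × Y) =>
        barI c (p.1 : Measure X) p.2) ∧
    ∀ (μ : ProbabilityMeasure X) (π : ProbabilityMeasure (X × Y)),
      (π : Measure (X × Y)).fst ≪ (μ : Measure X) →
        barI c (μ : Measure X) π = Icmu c (μ : Measure X) π := by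
  obtain ⟨a, b, hab⟩ := hA
  refine ⟨fun p z hz => ?_, fun μ π hπ => ?_⟩
  · obtain ⟨e, he, hze⟩ := exists_subAffine_lt_of_lt_barI hab hz
    have hcont : Continuous fun q : ProbabilityMeasure X × ProbabilityMeasure (X × Y) =>
        ((∫ x, e.1 x ∂(q.1 : Measure X) + ∫ z, e.2 z ∂(q.2 : Measure (X × Y)) : ℝ) : EReal) :=
      continuous_coe_real_ereal.comp
        (((ProbabilityMeasure.continuous_integral_boundedContinuousFunction
          (BoundedContinuousFunction.mkOfCompact e.1)).comp continuous_fst).add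
        ((ProbabilityMeasure.continuous_integral_boundedContinuousFunction
          (BoundedContinuousFunction.mkOfCompact e.2)).comp continuous_snd))
    filter_upwards [hcont.continuousAt.eventually (lt_mem_nhds hze)] with q hq
    exact hq.trans_le (he.le_barI hab)
  · rw [barI, Icmu, (Measure.singularPart_eq_zero _ _).2 hπ, eintegral_zero_measure, add_zero]

end UWOT
end
end
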